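/- Let d : Fin m → ℂ and let f : Fin n → Fin m be any function. Consider the n×n matrix M with entries M(i,j) = d(f i) if f i = f j, and M(i,j) = 0 otherwise (i.e. M is the submatrix of the diagonal matrix diag(d) with rows and columns selected by f). Then the permanent of M equals (Π_{i} d(f i)) multiplied by the number of permutations σ of Fin n satisfying f ∘ σ = f. -/

import Mathlib

open Matrix

/-- The permanent of a square matrix. -/
noncomputable def perm {n : ℕ} (M : Matrix (Fin n) (Fin n) ℂ) : ℂ :=
  ∑ σ : Equiv.Perm (Fin n), ∏ i, M i (σ i)

/-- The permanent of the submatrix of a diagonal matrix `diag(d)` with rows and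
columns selected by `f` equals `(Π i, d (f i))` times the number of permutations `σ`
with `f ∘ σ = f`. -/
theorem perm_diagonal_submatrix {m n : ℕ} (d : Fin m → ℂ) (f : Fin n → Fin m) :
    perm ((Matrix.diagonal d).submatrix f f) =
      (∏ i, d (f i)) *
        ((Finset.univ.filter (fun σ : Equiv.Perm (Fin n) => f ∘ σ = f)).card : ℂ) := by
  rw [perm, mul_comm, ← nsmul_eq_mul, ← Finset.sum_const, Finset.sum_filter]
  refine Finset.sum_congr rfl fun σ _ => ?_
  split_ifs with h
  · refine Finset.prod_congr rfl fun i _ => ?_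
    have hi : f (σ i) = f i := congrFun h i
    simp [hi]
  · obtain ⟨i, hi⟩ := Function.ne_iff.mp h
    exact Finset.prod_eq_zero (Finset.mem_univ i) (Matrix.diagonal_apply_ne' d hi)
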